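/- arXiv:1702.00291 — 2 statements merged into one kernel-verified Lean document; each statement's English description precedes it below -/
import Mathlib

section
/- Let p be a prime, k a field of characteristic p, and let B and B' be reduced commutative k-algebras. Then the tensor product R = B ⊗_k B' is Frobenius separated: for every n ≥ 1, the intersection ⋂_{m ≥ 1} (ker F_R^n)^m of all powers of the ideal ker(F_R^n) = {x ∈ R : x^{p^n} = 0} is the zero ideal. -/
/-- The ideal `ker(F_R^n) = {x : R | x^(p^n) = 0}` of a ring of characteristic `p`
(realized as the ideal generated by that set). -/
def frobeniusPowerKernel (p : ℕ) (R : Type*) [CommRing R] (n : ℕ) : Ideal R :=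
  Ideal.span {x : R | x ^ p ^ n = 0}

/-- A ring `R` (of characteristic `p`) is Frobenius separated if for every `n ≥ 1`
the intersection of all powers of `ker(F_R^n)` is zero. -/
def IsFrobeniusSeparated (p : ℕ) (R : Type*) [CommRing R] : Prop :=
  ∀ n : ℕ, 1 ≤ n → (⨅ m ≥ 1, frobeniusPowerKernel p R n ^ m) = ⊥

universe u v w

/-- If every `p`-th power of `l` comes from `k`, the set `U` satisfies this property when compatible
choices of `p`-th roots for the elements of `U` always extend to algebra homomorphisms. -/
def LiftsPthRoots (p : ℕ) (k : Type u) {l : Type v} [Field k] [Field l] [Algebra k l]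
    (U : Set l) : Prop :=
  ∀ (C : Type w) [CommRing C] [Algebra k C] (c : l → C),
    (∀ u ∈ U, ∀ a : k, algebraMap k l a = u ^ p → c u ^ p = algebraMap k C a) →
    ∃ g : Algebra.adjoin k U →ₐ[k] C, ∀ x (hx : x ∈ U), g ⟨x, Algebra.subset_adjoin hx⟩ = c x

section

variable {p : ℕ} {k : Type u} {l : Type v} [Field k] [Field l] [Algebra k l]

lemma liftsPthRoots_empty : LiftsPthRoots.{u, v, w} p k (∅ : Set l) := by
  intro C _ _ c _
  exact ⟨((Algebra.ofId k C).comp (Algebra.botEquiv k l).toAlgHom).comp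
    (Subalgebra.inclusion (Algebra.adjoin_empty k l).le), by simp⟩

lemma LiftsPthRoots.sUnion {S : Set (Set l)} (hS : IsChain (· ⊆ ·) S) (hne : S.Nonempty)
    (h : ∀ U ∈ S, LiftsPthRoots.{u, v, w} p k U) : LiftsPthRoots.{u, v, w} p k (⋃₀ S) := by
  intro C _ _ c hc
  choose g hg using fun U : S => h U U.2 C c fun u hu => hc u ⟨U, U.2, hu⟩
  have : Nonempty S := hne.to_subtype
  have hsup : Algebra.adjoin k (⋃₀ S) ≤ ⨆ U : S, Algebra.adjoin k (U : Set l) := by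
    rw [Set.sUnion_eq_iUnion]
    exact (Algebra.gc.l_iSup (f := fun U : S => (U : Set l))).le
  have hdir : Directed (· ≤ ·) fun U : S => Algebra.adjoin k (U : Set l) := by
    intro U V
    rcases hS.total U.2 V.2 with h | h
    · exact ⟨V, Algebra.adjoin_mono h, le_rfl⟩
    · exact ⟨U, le_rfl, Algebra.adjoin_mono h⟩
  have hcompat : ∀ (U V : S) (hUV : Algebra.adjoin k (U : Set l) ≤ Algebra.adjoin k (V : Set l)),
      g U = (g V).comp (Subalgebra.inclusion hUV) := by
    intro U V hUV
    rcases hS.total U.2 V.2 with h | h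
    · refine AlgHom.adjoin_ext fun x hx => ?_
      rw [hg U x hx]
      exact (hg V x (h hx)).symm
    · have key : (g V) = (g U).comp (Subalgebra.inclusion (Algebra.adjoin_mono h)) := by
        refine AlgHom.adjoin_ext fun x hx => ?_
        rw [hg V x hx]
        exact (hg U x (h hx)).symm
      refine AlgHom.ext fun x => ?_
      rw [key, AlgHom.comp_apply, AlgHom.comp_apply, Subalgebra.inclusion_inclusion,
        Subalgebra.inclusion_self, AlgHom.id_apply]
  refine ⟨Subalgebra.iSupLift _ hdir g hcompat _ hsup, ?_⟩
  rintro x ⟨U, hU, hx⟩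
  exact (Subalgebra.iSupLift_of_mem (K := fun U : S => Algebra.adjoin k (U : Set l))
    (i := ⟨U, hU⟩) ⟨x, Algebra.subset_adjoin (Set.mem_sUnion_of_mem hx hU)⟩
    (Algebra.subset_adjoin hx)).trans
    (hg ⟨U, hU⟩ x hx)

lemma exists_algHom_adjoin_singleton_apply_eq {F L C : Type*} [Field F] [Field L] [Algebra F L]
    [CommRing C] [Algebra F C] {y : L} {z : C} (hz : Polynomial.aeval z (minpoly F y) = 0) :
    ∃ g : Algebra.adjoin F {y} →ₐ[F] C, g ⟨y, Algebra.self_mem_adjoin_singleton F y⟩ = z := by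
  refine ⟨Algebra.adjoin.liftSingleton F y z hz, ?_⟩
  have hy : (AlgEquiv.adjoinSingletonEquivAdjoinRootMinpoly F y)
      ⟨y, Algebra.self_mem_adjoin_singleton F y⟩ = AdjoinRoot.root _ := by
    rw [← AlgEquiv.eq_symm_apply]
    simp
  exact (congrArg (AdjoinRoot.liftAlgHom _ _ z hz) hy).trans (AdjoinRoot.liftAlgHom_root _ _ _ hz)

lemma LiftsPthRoots.insert_of_notMem_adjoin [Fact p.Prime] [CharP l p]
    (hkl : ∀ x : l, ∃ a : k, algebraMap k l a = x ^ p) {U : Set l}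
    (hU : LiftsPthRoots.{u, v, w} p k U) {y : l} (hy : y ∉ Algebra.adjoin k U) :
    LiftsPthRoots.{u, v, w} p k (insert y U) := by
  intro C _ _ c hc
  obtain ⟨g, hg⟩ := hU C c fun u hu => hc u (Set.mem_insert_of_mem _ hu)
  have hp : p.Prime := Fact.out
  have hint : ∀ x : l, IsIntegral k x := fun x => by
    obtain ⟨a, ha⟩ := hkl x
    exact ⟨Polynomial.X ^ p - Polynomial.C a, Polynomial.monic_X_pow_sub_C a hp.ne_zero,
      by simp [ha]⟩
  have : Algebra.IsAlgebraic k l := ⟨fun x => (hint x).isAlgebraic⟩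
  let _ : Field (Algebra.adjoin k U) := (Subalgebra.isField_of_algebraic _).toField
  let _ : Algebra (Algebra.adjoin k U) C := g.toRingHom.toAlgebra
  have : IsScalarTower k (Algebra.adjoin k U) C :=
    IsScalarTower.of_algebraMap_eq fun a => (g.commutes a).symm
  obtain ⟨a, ha⟩ := hkl y
  have hmin : minpoly (Algebra.adjoin k U) y =
      Polynomial.X ^ p - Polynomial.C (algebraMap k (Algebra.adjoin k U) a) := by
    symm
    apply minpoly.eq_of_irreducible_of_monic
    · refine X_pow_sub_C_irreducible_of_prime hp fun b hb => hy ?_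
      have h1 : (b : l) ^ p = y ^ p := by
        rw [← ha]; exact congrArg Subtype.val hb
      have h2 : (b : l) = y := frobenius_inj l p h1
      exact h2 ▸ b.2
    · simp only [map_sub, map_pow, Polynomial.aeval_X, Polynomial.aeval_C]
      rw [← IsScalarTower.algebraMap_apply, ha, sub_self]
    · exact Polynomial.monic_X_pow_sub_C _ hp.ne_zero
  have hroot : Polynomial.aeval (c y) (minpoly (Algebra.adjoin k U) y) = 0 := by
    rw [hmin]
    simp only [map_sub, map_pow, Polynomial.aeval_X, Polynomial.aeval_C]
    rw [← IsScalarTower.algebraMap_apply, hc y (Set.mem_insert _ _) a ha, sub_self]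
  obtain ⟨G, hG⟩ := exists_algHom_adjoin_singleton_apply_eq hroot
  have hle : Algebra.adjoin k (insert y U) ≤
      (Algebra.adjoin (Algebra.adjoin k U) {y}).restrictScalars k := by
    rw [← Algebra.adjoin_union_eq_adjoin_adjoin, Set.union_singleton]
  refine ⟨(G.restrictScalars k).comp (Subalgebra.inclusion hle), ?_⟩
  rintro x (rfl | hx)
  · exact hG
  · exact (G.commutes ⟨x, Algebra.subset_adjoin hx⟩).trans (hg x hx)

variable (p k l) in
/-- A set of generators behaving like a `p`-basis. -/
theorem exists_liftsPthRoots_adjoin_eq_top [Fact p.Prime] [CharP l p]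
    (hkl : ∀ x : l, ∃ a : k, algebraMap k l a = x ^ p) :
    ∃ T : Set l, LiftsPthRoots.{u, v, w} p k T ∧ Algebra.adjoin k T = ⊤ := by
  obtain ⟨T, -, hT⟩ := zorn_subset_nonempty {U : Set l | LiftsPthRoots.{u, v, w} p k U}
    (fun S hS hchain hne => ⟨⋃₀ S, LiftsPthRoots.sUnion hchain hne hS,
      fun _ => Set.subset_sUnion_of_mem⟩) ∅ liftsPthRoots_empty
  refine ⟨T, hT.prop, eq_top_iff.2 fun y _ => ?_⟩
  by_contra hy
  exact hy (Algebra.subset_adjoin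
    (hT.le_of_ge (hT.prop.insert_of_notMem_adjoin hkl hy) (Set.subset_insert y T)
      (Set.mem_insert y T)))

end

/-- A field of characteristic `p` has a set `T` of generators over each of its subfields of
`p ^ n`-th powers such that ring homomorphisms lift along the iterated Frobenius as soon as
`p ^ n`-th roots of the images of the elements of `T` are given. -/
theorem exists_generators_lifting_iterateFrobenius (p : ℕ) [Fact p.Prime] (l : Type u) [Field l]
    [CharP l p] : ∃ T : Set l,
      (∀ n : ℕ, Subring.closure (Set.range (fun a : l => a ^ p ^ n) ∪ T) = ⊤) ∧
      ∀ (n : ℕ) (C : Type w) [CommRing C] (f : l →+* C) (c : l → C),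
        (∀ t ∈ T, c t ^ p ^ n = f t) →
        ∃ g : l →+* C, (∀ a, g a ^ p ^ n = f a) ∧ ∀ t ∈ T, g t = c t := by
  let k := (frobenius l p).fieldRange
  let e : l ≃+* k := RingEquiv.ofBijective (frobenius l p).rangeRestrictField
    ⟨(frobenius l p).rangeRestrictField.injective, (frobenius l p).rangeRestrict_surjective⟩
  have he : ∀ a : l, algebraMap k l (e a) = a ^ p := fun a => rfl
  obtain ⟨T, hlift, hT⟩ := exists_liftsPthRoots_adjoin_eq_top.{u, u, w} p k l
    fun x => ⟨e x, he x⟩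
  refine ⟨T, fun n => ?_, fun n => ?_⟩
  · have h1 : ∀ x : l, x ∈ Subring.closure (Set.range (fun a : l => a ^ p) ∪ T) := by
      intro x
      have hx : x ∈ Algebra.adjoin k T := hT ▸ Algebra.mem_top
      induction hx using Algebra.adjoin_induction with
      | mem x hx => exact Subring.subset_closure (Or.inr hx)
      | algebraMap r =>
        obtain ⟨b, rfl⟩ := e.surjective r
        exact Subring.subset_closure (Or.inl ⟨b, (he b).symm⟩)
      | add x y _ _ hx hy => exact add_mem hx hy
      | mul x y _ _ hx hy => exact mul_mem hx hy
    induction n with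
    | zero =>
      refine eq_top_iff.2 fun x _ => Subring.subset_closure (Or.inl ⟨x, by simp⟩)
    | succ n ih =>
      have h2 : ∀ x : l,
          x ^ p ∈ Subring.closure (Set.range (fun a : l => a ^ p ^ (n + 1)) ∪ T) := by
        intro x
        have hx : x ∈ Subring.closure (Set.range (fun a : l => a ^ p ^ n) ∪ T) :=
          ih ▸ Subring.mem_top x
        induction hx using Subring.closure_induction with
        | mem x hx =>
          rcases hx with ⟨b, rfl⟩ | hx
          · exact Subring.subset_closure (Or.inl ⟨b, by simp [pow_succ, pow_mul]⟩)
          · exact pow_mem (Subring.subset_closure (Set.mem_union_right _ hx)) p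
        | zero => rw [← frobenius_def (R := l) (p := p), map_zero]; exact zero_mem _
        | one => rw [one_pow]; exact one_mem _
        | add x y _ _ hx hy => rw [← frobenius_def (R := l) (p := p), map_add]; exact add_mem hx hy
        | neg x _ hx => rw [← frobenius_def (R := l) (p := p), map_neg]; exact neg_mem hx
        | mul x y _ _ hx hy => rw [mul_pow]; exact mul_mem hx hy
      refine eq_top_iff.2 fun x _ => ?_
      refine (Subring.closure_le.2 ?_) (h1 x)
      rintro _ (⟨b, rfl⟩ | hx)
      · exact h2 b
      · exact Subring.subset_closure (Or.inr hx)
  · induction n with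
    | zero =>
      intro C _ f c hc
      exact ⟨f, by simp, fun t ht => by simpa using (hc t ht).symm⟩
    | succ n ih =>
      intro C _ f c hc
      let _ : Algebra k C := (f.comp e.symm.toRingHom).toAlgebra
      have hf : ∀ a, algebraMap k C (e a) = f a := fun a => congrArg f (e.symm_apply_apply a)
      obtain ⟨g, hg⟩ := hlift C (fun t => c t ^ p ^ n) (by
        intro u hu a ha
        obtain ⟨b, rfl⟩ := e.surjective a
        have hb : b = u := frobenius_inj l p ha
        rw [hf, hb, ← hc u hu, pow_succ, pow_mul])
      let g' : l →+* C := g.toRingHom.comp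
        ((Subring.inclusion (show (⊤ : Subring l) ≤ (Algebra.adjoin k T).toSubring by
          simp [hT])).comp Subring.topEquiv.symm.toRingHom)
      have hg'T : ∀ t ∈ T, g' t = c t ^ p ^ n := hg
      have hg' : ∀ a, g' a ^ p = f a := by
        intro a
        rw [← map_pow, ← hf, ← he]
        exact g.commutes (e a)
      obtain ⟨g₁, h₁, h₂⟩ := ih C g' c fun t ht => (hg'T t ht).symm
      exact ⟨g₁, fun a => by rw [pow_succ, pow_mul, h₁, hg'], h₂⟩

section

open scoped TensorProduct

lemma TensorProduct.exists_ne_zero_forall_lTensor_ne_zero {k : Type*} [Field k] {W A : Type*}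
    [AddCommGroup W] [Module k W] [AddCommGroup A] [Module k A] {x : W ⊗[k] A} (hx : x ≠ 0) :
    ∃ a : A, a ≠ 0 ∧ ∀ (V : Type w) [AddCommGroup V] [Module k V] (f : A →ₗ[k] V),
      f a ≠ 0 → f.lTensor W x ≠ 0 := by
  classical
  let b := Module.Basis.ofVectorSpace k W
  have hx' : TensorProduct.equivFinsuppOfBasisLeft b x ≠ 0 := by simpa using hx
  obtain ⟨i, hi⟩ := Finsupp.ne_iff.1 hx'
  refine ⟨_, hi, fun V _ _ f hf h0 => hf ?_⟩
  have key : ∀ y : W ⊗[k] A, f (TensorProduct.equivFinsuppOfBasisLeft b y i) =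
      TensorProduct.equivFinsuppOfBasisLeft b (f.lTensor W y) i := by
    intro y
    induction y with
    | zero => simp
    | tmul w a => simp
    | add y z hy hz => simp [hy, hz]
  rw [key, h0]
  simp

lemma exists_finset_forall_ringHom_fix {k l A : Type*} [Field k] [Field l] [CommRing A]
    [Algebra k l] [Algebra k A] {q : ℕ} {T : Set l}
    (hT : Subring.closure (Set.range (fun a : l => a ^ q) ∪ T) = ⊤)
    (hkl : ∀ b : l, ∃ a : k, algebraMap k l a = b ^ q) (a : l ⊗[k] A) :
    ∃ T₀ : Finset l, (T₀ : Set l) ⊆ T ∧ ∀ π : l ⊗[k] A →+* l ⊗[k] A,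
      (∀ b : A, π (1 ⊗ₜ b) = 1 ⊗ₜ b) → (∀ t ∈ T₀, π (t ⊗ₜ 1) = t ⊗ₜ 1) → π a = a := by
  classical
  have hadd : ∀ x y : l ⊗[k] A,
      (∃ T₀ : Finset l, (T₀ : Set l) ⊆ T ∧ ∀ π : l ⊗[k] A →+* l ⊗[k] A,
        (∀ b : A, π (1 ⊗ₜ b) = 1 ⊗ₜ b) → (∀ t ∈ T₀, π (t ⊗ₜ 1) = t ⊗ₜ 1) → π x = x) →
      (∃ T₀ : Finset l, (T₀ : Set l) ⊆ T ∧ ∀ π : l ⊗[k] A →+* l ⊗[k] A,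
        (∀ b : A, π (1 ⊗ₜ b) = 1 ⊗ₜ b) → (∀ t ∈ T₀, π (t ⊗ₜ 1) = t ⊗ₜ 1) → π y = y) →
      ∃ T₀ : Finset l, (T₀ : Set l) ⊆ T ∧ ∀ π : l ⊗[k] A →+* l ⊗[k] A,
        (∀ b : A, π (1 ⊗ₜ b) = 1 ⊗ₜ b) → (∀ t ∈ T₀, π (t ⊗ₜ 1) = t ⊗ₜ 1) →
        π x = x ∧ π y = y := by
    rintro x y ⟨T₁, h₁, h₁'⟩ ⟨T₂, h₂, h₂'⟩
    refine ⟨T₁ ∪ T₂, by simp [h₁, h₂], fun π hπ hT => ⟨h₁' π hπ fun t ht => hT t ?_,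
      h₂' π hπ fun t ht => hT t ?_⟩⟩
    · exact Finset.mem_union_left _ ht
    · exact Finset.mem_union_right _ ht
  induction a with
  | zero => exact ⟨∅, by simp, fun π _ _ => map_zero π⟩
  | add x y hx hy =>
    obtain ⟨T₀, h, h'⟩ := hadd x y hx hy
    exact ⟨T₀, h, fun π hπ hT => by rw [map_add, (h' π hπ hT).1, (h' π hπ hT).2]⟩
  | tmul c b =>
    suffices h : ∃ T₀ : Finset l, (T₀ : Set l) ⊆ T ∧ ∀ π : l ⊗[k] A →+* l ⊗[k] A,
        (∀ b : A, π (1 ⊗ₜ b) = 1 ⊗ₜ b) → (∀ t ∈ T₀, π (t ⊗ₜ 1) = t ⊗ₜ 1) →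
        π (c ⊗ₜ 1) = c ⊗ₜ 1 by
      obtain ⟨T₀, h, h'⟩ := h
      refine ⟨T₀, h, fun π hπ hT => ?_⟩
      have hcb : c ⊗ₜ[k] b = (c ⊗ₜ 1) * (1 ⊗ₜ b) := by simp
      rw [hcb, map_mul, hπ, h' π hπ hT]
    have hc : c ∈ Subring.closure (Set.range (fun a : l => a ^ q) ∪ T) := hT ▸ Subring.mem_top c
    induction hc using Subring.closure_induction with
    | mem x hx =>
      rcases hx with ⟨y, rfl⟩ | hx
      · obtain ⟨r, hr⟩ := hkl y
        refine ⟨∅, by simp, fun π hπ _ => ?_⟩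
        have hy : (y ^ q) ⊗ₜ[k] (1 : A) = 1 ⊗ₜ algebraMap k A r := by
          rw [← hr, ← Algebra.TensorProduct.algebraMap_apply']
          rfl
        dsimp only
        rw [hy, hπ]
      · exact ⟨{x}, by simpa using hx, fun π _ hT => hT x (Finset.mem_singleton_self x)⟩
    | zero => exact ⟨∅, by simp, fun π _ _ => by rw [TensorProduct.zero_tmul, map_zero]⟩
    | one => exact ⟨∅, by simp, fun π hπ _ => hπ 1⟩
    | add x y _ _ hx hy =>
      obtain ⟨T₀, h, h'⟩ := hadd _ _ hx hy
      exact ⟨T₀, h, fun π hπ hT => by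
        rw [TensorProduct.add_tmul, map_add, (h' π hπ hT).1, (h' π hπ hT).2]⟩
    | neg x _ hx =>
      obtain ⟨T₀, h, h'⟩ := hx
      exact ⟨T₀, h, fun π hπ hT => by rw [TensorProduct.neg_tmul, map_neg, h' π hπ hT]⟩
    | mul x y _ _ hx hy =>
      obtain ⟨T₀, h, h'⟩ := hadd _ _ hx hy
      refine ⟨T₀, h, fun π hπ hT => ?_⟩
      have hxy : (x * y) ⊗ₜ[k] (1 : A) = (x ⊗ₜ 1) * (y ⊗ₜ 1) := by simp
      rw [hxy, map_mul, (h' π hπ hT).1, (h' π hπ hT).2]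

lemma map_mem_frobeniusPowerKernel_pow {p n m : ℕ} {R S : Type*} [CommRing R] [CommRing S]
    (h : R →+* S) {x : R} (hx : x ∈ frobeniusPowerKernel p R n ^ m) :
    h x ∈ frobeniusPowerKernel p S n ^ m := by
  have h1 : (frobeniusPowerKernel p R n).map h ≤ frobeniusPowerKernel p S n := by
    rw [frobeniusPowerKernel, Ideal.map_span]
    refine Ideal.span_mono ?_
    rintro _ ⟨y, hy, rfl⟩
    change h y ^ p ^ n = 0
    rw [← map_pow, show y ^ p ^ n = 0 from hy, map_zero]
  exact Ideal.pow_right_mono h1 m (Ideal.map_pow h _ m ▸ Ideal.mem_map_of_mem h hx)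

section

variable (p n : ℕ) [Fact p.Prime] {k : Type u} {Ω : Type v} {Ω' : Type w} [Field k] [Field Ω]
  [Field Ω'] [Algebra k Ω] [Algebra k Ω'] [CharP k p] [CharP Ω p] [CharP Ω' p] [PerfectRing Ω p]
  [PerfectRing Ω' p]

lemma map_eq_zero_of_pow_eq_zero {Q : Type*} [CommRing Q] (h : Ω ⊗[k] Ω' →+* Q)
    (hh : ∀ a : k, h ((iterateFrobeniusEquiv Ω p n).symm (algebraMap k Ω a) ⊗ₜ 1) =
      h (1 ⊗ₜ (iterateFrobeniusEquiv Ω' p n).symm (algebraMap k Ω' a)))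
    {y : Ω ⊗[k] Ω'} (hy : y ^ p ^ n = 0) : h y = 0 := by
  have : CharP (Ω ⊗[k] Ω') p := charP_of_injective_algebraMap' k p
  let s := (iterateFrobeniusEquiv Ω p n).symm
  let s' := (iterateFrobeniusEquiv Ω' p n).symm
  let i : Ω →+* Q := h.comp (Algebra.TensorProduct.includeLeftRingHom)
  let i' : Ω' →+* Q := h.comp (Algebra.TensorProduct.includeRight : Ω' →ₐ[k] Ω ⊗[k] Ω').toRingHom
  let _ : Algebra k Q := ((i.comp s.toRingHom).comp (algebraMap k Ω)).toAlgebra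
  let f : Ω →ₐ[k] Q := { i.comp s.toRingHom with commutes' := fun a => rfl }
  let f' : Ω' →ₐ[k] Q := { i'.comp s'.toRingHom with commutes' := fun a => (hh a).symm }
  have hs : ∀ a, s (a ^ p ^ n) = a := fun a => (iterateFrobeniusEquiv Ω p n).symm_apply_apply a
  have hs' : ∀ a, s' (a ^ p ^ n) = a := fun a => (iterateFrobeniusEquiv Ω' p n).symm_apply_apply a
  have key : ∀ z, Algebra.TensorProduct.productMap f f' (iterateFrobenius _ p n z) = h z := by
    intro z
    induction z with
    | zero => simp only [map_zero]
    | tmul a b =>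
      rw [iterateFrobenius_def, Algebra.TensorProduct.tmul_pow,
        Algebra.TensorProduct.productMap_apply_tmul]
      change h (s (a ^ p ^ n) ⊗ₜ 1) * h (1 ⊗ₜ s' (b ^ p ^ n)) = _
      rw [hs, hs', ← map_mul, Algebra.TensorProduct.tmul_mul_tmul, one_mul, mul_one]
    | add y z hy hz => simp only [map_add, hy, hz]
  rw [← key, iterateFrobenius_def, hy, map_zero]

theorem iInf_frobeniusPowerKernel_pow_eq_bot_of_perfectRing :
    (⨅ m ≥ 1, frobeniusPowerKernel p (Ω ⊗[k] Ω') n ^ m) = ⊥ := by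
  obtain ⟨l, _, ⟨e⟩⟩ : ∃ (l : Type u) (_ : Field l), Nonempty (l ≃+* k) :=
    ⟨k, inferInstance, ⟨RingEquiv.refl k⟩⟩
  have : CharP l p := (RingHom.charP_iff e.toRingHom e.injective p).2 inferInstance
  obtain ⟨T, hgen, hlift⟩ := exists_generators_lifting_iterateFrobenius.{u, max u w} p l
  let s := (iterateFrobeniusEquiv Ω p n).symm
  let s' := (iterateFrobeniusEquiv Ω' p n).symm
  let _ : Algebra k l := (e.symm.toRingHom.comp (iterateFrobenius k p n)).toAlgebra
  let _ : Algebra l Ω := (s.toRingHom.comp ((algebraMap k Ω).comp e.toRingHom)).toAlgebra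
  let _ : Algebra l Ω' := (s'.toRingHom.comp ((algebraMap k Ω').comp e.toRingHom)).toAlgebra
  have hkl : ∀ a : l, algebraMap k l (e a) = a ^ p ^ n := fun a => by
    change e.symm (e a ^ p ^ n) = _
    rw [← map_pow, e.symm_apply_apply]
  have hlΩ : ∀ a : l, algebraMap l Ω a = s (algebraMap k Ω (e a)) := fun a => rfl
  have hlΩ' : ∀ a : l, algebraMap l Ω' a = s' (algebraMap k Ω' (e a)) := fun a => rfl
  have hs : ∀ a, s (a ^ p ^ n) = a := fun a => (iterateFrobeniusEquiv Ω p n).symm_apply_apply a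
  have hs' : ∀ a, s' (a ^ p ^ n) = a := fun a => (iterateFrobeniusEquiv Ω' p n).symm_apply_apply a
  have : IsScalarTower k l Ω := IsScalarTower.of_algebraMap_eq fun a => by
    rw [hlΩ]
    change _ = s (algebraMap k Ω (e (e.symm (a ^ p ^ n))))
    rw [e.apply_symm_apply, map_pow, hs]
  have : IsScalarTower k l Ω' := IsScalarTower.of_algebraMap_eq fun a => by
    rw [hlΩ']
    change _ = s' (algebraMap k Ω' (e (e.symm (a ^ p ^ n))))
    rw [e.apply_symm_apply, map_pow, hs']
  rw [eq_bot_iff]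
  intro x hx
  simp only [Ideal.mem_iInf] at hx
  by_contra hx0
  let φ := (Algebra.TensorProduct.cancelBaseChange k l l Ω Ω').symm
  have hφ : φ x ≠ 0 := by simpa using hx0
  obtain ⟨a, ha0, ha⟩ :=
    TensorProduct.exists_ne_zero_forall_lTensor_ne_zero.{max u w} hφ
  have hpow : ∀ b : l, (b ^ p ^ n) ⊗ₜ[k] (1 : Ω') = algebraMap k (l ⊗[k] Ω') (e b) := fun b => by
    rw [← hkl]; rfl
  have hpow' : ∀ b : l, (1 : l) ⊗ₜ[k] (algebraMap l Ω' b ^ p ^ n) =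
      algebraMap k (l ⊗[k] Ω') (e b) := fun b => by
    rw [← map_pow, ← hkl, ← IsScalarTower.algebraMap_apply,
      ← Algebra.TensorProduct.algebraMap_apply']
  obtain ⟨T₀, hT₀, hfix⟩ := exists_finset_forall_ringHom_fix (hgen n) (fun b => ⟨e b, hkl b⟩) a
  classical
  obtain ⟨g, hg, hgT⟩ := hlift n (l ⊗[k] Ω') ((algebraMap k (l ⊗[k] Ω')).comp e.toRingHom)
    (fun t => if t ∈ T₀ then t ⊗ₜ 1 else 1 ⊗ₜ algebraMap l Ω' t) (by
      intro t _
      split_ifs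
      · rw [Algebra.TensorProduct.tmul_pow, one_pow, hpow]; rfl
      · rw [Algebra.TensorProduct.tmul_pow, one_pow, hpow']; rfl)
  let gk : l →ₐ[k] l ⊗[k] Ω' := { g with
    commutes' := fun b => by
      obtain ⟨b, rfl⟩ := e.surjective b
      rw [hkl]
      exact (map_pow g b _).trans (hg b) }
  let J₀ : Ideal (l ⊗[k] Ω') := Ideal.span
    ((fun t : l => t ⊗ₜ[k] (1 : Ω') - 1 ⊗ₜ algebraMap l Ω' t) '' T₀)
  have : CharP (l ⊗[k] Ω') p := charP_of_injective_algebraMap' k p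
  have hJ₀ : IsNilpotent J₀ := by
    rw [Ideal.FG.isNilpotent_iff_le_nilradical ⟨T₀.image fun t =>
      t ⊗ₜ[k] (1 : Ω') - 1 ⊗ₜ algebraMap l Ω' t,
      by rw [Finset.coe_image]⟩]
    refine Ideal.span_le.2 ?_
    rintro _ ⟨t, -, rfl⟩
    refine mem_nilradical.2 ⟨p ^ n, ?_⟩
    dsimp only
    rw [← iterateFrobenius_def, map_sub, iterateFrobenius_def, iterateFrobenius_def,
      Algebra.TensorProduct.tmul_pow, Algebra.TensorProduct.tmul_pow, one_pow, one_pow, hpow,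
      hpow', sub_self]
  have hgJ₀ : ∀ b : l, g b - 1 ⊗ₜ algebraMap l Ω' b ∈ J₀ := by
    let r : l →+* l ⊗[k] Ω' := (Algebra.TensorProduct.includeRight : Ω' →ₐ[k] _).toRingHom.comp
      (algebraMap l Ω')
    have hr : ∀ b, r b = 1 ⊗ₜ algebraMap l Ω' b := fun b => rfl
    have : (Ideal.Quotient.mk J₀).comp g = (Ideal.Quotient.mk J₀).comp r := by
      refine RingHom.eq_of_eqOn_set_dense (hgen n) ?_
      rintro _ (⟨b, rfl⟩ | ht)
      · refine congrArg (Ideal.Quotient.mk J₀) ?_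
        dsimp only
        rw [map_pow, hg, map_pow, hr, Algebra.TensorProduct.tmul_pow, one_pow, hpow']
        rfl
      · rename_i t
        refine Ideal.Quotient.eq.2 ?_
        rw [hgT t ht, hr]
        split_ifs with h
        · exact Ideal.subset_span ⟨t, h, rfl⟩
        · rw [sub_self]; exact zero_mem _
    exact fun b => Ideal.Quotient.eq.1 (RingHom.congr_fun this b)
  obtain ⟨C, _, ⟨ρ⟩⟩ : ∃ (C : Type (max u w)) (_ : CommRing C), Nonempty ((l ⊗[k] Ω') ≃+* C) :=
    ⟨_, inferInstance, ⟨RingEquiv.refl _⟩⟩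
  let _ : Algebra l C := (ρ.toRingHom.comp g).toAlgebra
  let π₀ : l ⊗[k] Ω' →ₐ[k] l ⊗[k] Ω' :=
    Algebra.TensorProduct.productMap gk Algebra.TensorProduct.includeRight
  have hπl : ∀ b : l, π₀ (b ⊗ₜ 1) = g b := fun b => by
    change gk b * 1 = _
    rw [mul_one]
    rfl
  have hπr : ∀ b : Ω', π₀ (1 ⊗ₜ b) = 1 ⊗ₜ b := fun b => by simp [π₀]
  let π : l ⊗[k] Ω' →ₐ[l] C := { ρ.toRingHom.comp π₀.toRingHom with
    commutes' := fun b => congrArg ρ (hπl b) }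
  have hπ : ∀ b, π b = ρ (π₀ b) := fun b => rfl
  let ψ : Ω ⊗[k] Ω' →+* Ω ⊗[l] C :=
    (Algebra.TensorProduct.map (AlgHom.id l Ω) π).toRingHom.comp φ.toRingEquiv.toRingHom
  have hψ : ∀ b b', ψ (b ⊗ₜ b') = b ⊗ₜ ρ (1 ⊗ₜ b') := fun b b' => by
    rw [← hπr, ← hπ]
    change Algebra.TensorProduct.map (AlgHom.id l Ω) π (φ (b ⊗ₜ b')) = _
    simp [φ]
  have hψx : ψ x ≠ 0 := by
    refine ha C π.toLinearMap ?_
    change ρ (π₀ a) ≠ 0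
    rw [show π₀ a = a from hfix π₀.toRingHom hπr fun t ht => ?_]
    · simpa using ha0
    · refine (hπl t).trans ((hgT t (hT₀ ht)).trans (if_pos ht))
  let i : l ⊗[k] Ω' →+* Ω ⊗[l] C :=
    (Algebra.TensorProduct.includeRight : C →ₐ[l] Ω ⊗[l] C).toRingHom.comp ρ.toRingHom
  have hle : frobeniusPowerKernel p (Ω ⊗[k] Ω') n ≤ (J₀.map i).comap ψ := by
    refine Ideal.span_le.2 fun y hy => ?_
    change ψ y ∈ J₀.map i
    refine Ideal.Quotient.eq_zero_iff_mem.1 (map_eq_zero_of_pow_eq_zero p n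
      ((Ideal.Quotient.mk (J₀.map i)).comp ψ) (fun b => ?_) hy)
    obtain ⟨b, rfl⟩ := e.surjective b
    refine Ideal.Quotient.eq.2 ?_
    rw [hψ, hψ]
    have h1 : algebraMap l Ω b ⊗ₜ[l] ρ (1 ⊗ₜ 1) = i (g b) := by
      rw [← Algebra.TensorProduct.one_def, map_one, ← Algebra.TensorProduct.algebraMap_apply,
        Algebra.TensorProduct.algebraMap_apply']
      rfl
    have h2 := Ideal.mem_map_of_mem i (hgJ₀ b)
    rw [map_sub, ← h1] at h2
    exact h2
  obtain ⟨m, hm⟩ := hJ₀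
  have hmem := Ideal.pow_right_mono hle (m + 1) (hx (m + 1) (Nat.le_add_left 1 m))
  have hmem' := Ideal.le_comap_pow ψ (m + 1) hmem
  rw [Ideal.mem_comap, ← Ideal.map_pow, pow_succ, hm, zero_mul, Ideal.zero_eq_bot,
    Ideal.map_bot] at hmem'
  exact hψx hmem'

end

lemma exists_algHom_algebraicallyClosed_ne_zero (k : Type*) {A : Type v} [Field k] [CommRing A]
    [Algebra k A] [IsReduced A] {a : A} (ha : a ≠ 0) :
    ∃ (Ω : Type v) (_ : Field Ω) (_ : Algebra k Ω) (f : A →ₐ[k] Ω), IsAlgClosed Ω ∧ f a ≠ 0 := by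
  have h : a ∉ nilradical A := by rwa [nilradical_eq_zero]
  rw [nilradical_eq_sInf, Ideal.mem_sInf] at h
  push Not at h
  obtain ⟨P, hP, haP⟩ := h
  have : P.IsPrime := hP
  let f : A →ₐ[k] AlgebraicClosure (FractionRing (A ⧸ P)) :=
    (IsScalarTower.toAlgHom k (A ⧸ P) _).comp (Ideal.Quotient.mkₐ k P)
  refine ⟨_, inferInstance, inferInstance, f, inferInstance, fun h0 => haP ?_⟩
  have hinj : Function.Injective
      (algebraMap (A ⧸ P) (AlgebraicClosure (FractionRing (A ⧸ P)))) := by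
    rw [IsScalarTower.algebraMap_eq (A ⧸ P) (FractionRing (A ⧸ P))]
    exact (algebraMap (FractionRing (A ⧸ P)) (AlgebraicClosure (FractionRing (A ⧸ P)))).injective.comp
      (IsFractionRing.injective (A ⧸ P) (FractionRing (A ⧸ P)))
  exact Ideal.Quotient.eq_zero_iff_mem.1 (hinj (h0.trans (map_zero _).symm))

end

open scoped TensorProduct in
/-- Lemma C.4: if `k` is a field of characteristic `p` and `B`, `B'` are reduced
commutative `k`-algebras, then `B ⊗_k B'` is Frobenius separated. -/
theorem isFrobeniusSeparated_tensorProduct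
    (p : ℕ) (hp : p.Prime) (k : Type*) [Field k] [CharP k p]
    (B B' : Type*) [CommRing B] [CommRing B'] [Algebra k B] [Algebra k B']
    [IsReduced B] [IsReduced B'] :
    IsFrobeniusSeparated p (B ⊗[k] B') := by
  have : Fact p.Prime := ⟨hp⟩
  intro n _
  rw [eq_bot_iff]
  intro x hx
  simp only [Ideal.mem_iInf] at hx
  by_contra hx0
  obtain ⟨b', hb', h'⟩ := TensorProduct.exists_ne_zero_forall_lTensor_ne_zero hx0
  obtain ⟨Ω', _, _, f', _, hf'⟩ := exists_algHom_algebraicallyClosed_ne_zero k hb'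
  have hx₁ := h' Ω' f'.toLinearMap hf'
  have hx₂ : TensorProduct.comm k B Ω' (f'.toLinearMap.lTensor B x) ≠ 0 := by
    simpa only [ne_eq, EmbeddingLike.map_eq_zero_iff] using hx₁
  obtain ⟨b, hb, h⟩ := TensorProduct.exists_ne_zero_forall_lTensor_ne_zero hx₂
  obtain ⟨Ω, _, _, f, _, hf⟩ := exists_algHom_algebraicallyClosed_ne_zero k hb
  have hx₃ := h Ω f.toLinearMap hf
  have : CharP Ω p := charP_of_injective_algebraMap' k p
  have : CharP Ω' p := charP_of_injective_algebraMap' k p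
  let F : B ⊗[k] B' →+* Ω' ⊗[k] Ω :=
    ((Algebra.TensorProduct.comm k Ω Ω').toAlgHom.comp
      (Algebra.TensorProduct.map f f')).toRingHom
  have hF : F x = f.toLinearMap.lTensor Ω'
      (TensorProduct.comm k B Ω' (f'.toLinearMap.lTensor B x)) := by
    clear hx hx0 h' hx₁ hx₂ h hx₃
    induction x with
    | zero => simp only [map_zero]
    | tmul a a' => rfl
    | add y z hy hz => simp only [map_add, hy, hz]
  refine hx₃ (hF ▸ ?_)
  have hmem : F x ∈ ⨅ m ≥ 1, frobeniusPowerKernel p (Ω' ⊗[k] Ω) n ^ m := by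
    simp only [Ideal.mem_iInf]
    exact fun m hm => map_mem_frobeniusPowerKernel_pow F (hx m hm)
  rwa [iInf_frobeniusPowerKernel_pow_eq_bot_of_perfectRing p n] at hmem
end

section
/- Let p be a prime and R a Noetherian commutative ring in which p·1_R is nilpotent. Let B be a flat commutative R-algebra whose nilradical is a nilpotent ideal. Then the tensor product B ⊗_R B is almost Frobenius separated: there exists a nilpotent ideal 𝔞 of B ⊗_R B with p·1 ∈ 𝔞 such that (B ⊗_R B)/𝔞 is Frobenius separated. -/
/-- A ring `R` is almost Frobenius separated if there is a nilpotent ideal `𝔞`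
containing `p` such that `R/𝔞` is Frobenius separated. -/
def IsAlmostFrobeniusSeparated (p : ℕ) (R : Type*) [CommRing R] : Prop :=
  ∃ 𝔞 : Ideal R, IsNilpotent 𝔞 ∧ (p : R) ∈ 𝔞 ∧ IsFrobeniusSeparated p (R ⧸ 𝔞)

open Polynomial in
/-- An element of a field of characteristic `p` which is not a `p`-th power generates the field over
some subfield containing all `p`-th powers but not the element itself. -/
theorem exists_subfield_adjoin_eq_top {L : Type*} [Field L] (p : ℕ) [Fact p.Prime] [CharP L p]
    {d : L} (hd : ∀ y : L, y ^ p ≠ d) :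
    ∃ M : Subfield L, (∀ y : L, y ^ p ∈ M) ∧ d ∉ M ∧ IntermediateField.adjoin M {d} = ⊤ := by
  have hp : p.Prime := Fact.out
  obtain ⟨M, hM₀, hM⟩ := zorn_le_nonempty₀
    {M : Subfield L | (frobenius L p).fieldRange ≤ M ∧ d ∉ M} (by
      intro c hc hchain y hy
      refine ⟨sSup c, ⟨(hc hy).1.trans (le_sSup hy), fun h ↦ ?_⟩, fun z hz ↦ le_sSup hz⟩
      obtain ⟨s, hs, hds⟩ :=
        (Subfield.mem_sSup_of_directedOn ⟨y, hy⟩ hchain.directedOn).1 h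
      exact (hc hs).2 hds) (frobenius L p).fieldRange
    ⟨le_rfl, fun ⟨y, hy⟩ ↦ hd y hy⟩
  obtain ⟨⟨-, hdM⟩, hmax⟩ := hM
  have hpow (y : L) : y ^ p ∈ M := hM₀ ⟨y, rfl⟩
  have hint (y : L) : IsIntegral M y :=
    ⟨X ^ p - C ⟨y ^ p, hpow y⟩, monic_X_pow_sub_C _ hp.ne_zero, by
      simp only [eval₂_sub, eval₂_X_pow, eval₂_C]
      exact sub_self _⟩
  have hfin (y : L) (hy : y ∉ M) :
      Module.finrank M (IntermediateField.adjoin M {y}) = p := by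
    have hirr : Irreducible (X ^ p - C (⟨y ^ p, hpow y⟩ : M)) := by
      refine X_pow_sub_C_irreducible_of_prime hp fun b hb ↦ hy ?_
      have : (b : L) ^ p = y ^ p := congrArg Subtype.val hb
      rw [← frobenius_inj L p this]
      exact b.2
    rw [IntermediateField.adjoin.finrank (hint y), ← minpoly.eq_of_irreducible_of_monic hirr
      (by
        simp only [map_sub, map_pow, aeval_X, aeval_C]
        exact sub_self _) (monic_X_pow_sub_C _ hp.ne_zero), natDegree_X_pow_sub_C]
  refine ⟨M, hpow, hdM, ?_⟩
  rw [eq_top_iff]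
  intro y _
  by_cases hy : y ∈ M
  · exact (IntermediateField.adjoin M {d}).algebraMap_mem ⟨y, hy⟩
  have hMy : M ≤ (IntermediateField.adjoin M {y}).toSubfield := fun z hz ↦
    (IntermediateField.adjoin M {y}).algebraMap_mem ⟨z, hz⟩
  have hd' : d ∈ IntermediateField.adjoin M {y} := by
    by_contra h
    exact hy (hmax (y := (IntermediateField.adjoin M {y}).toSubfield) ⟨hM₀.trans hMy, h⟩ hMy
      (IntermediateField.mem_adjoin_simple_self M y))
  have : FiniteDimensional M (IntermediateField.adjoin M {y}) :=
    IntermediateField.adjoin.finiteDimensional (hint y)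
  rw [IntermediateField.eq_of_le_of_finrank_eq
    (IntermediateField.adjoin_simple_le_iff.2 hd') ((hfin d hdM).trans (hfin y hy).symm)]
  exact IntermediateField.mem_adjoin_simple_self M y

open Polynomial in
/-- Let `d` be an element of a field `L` of characteristic `p` which is not a `p`-th power. If `t`
is an element of an `L`-algebra with `t ^ p ^ n = 0`, then `d ↦ d + t` extends to a ring
homomorphism which agrees with the structure map modulo `t`. -/
theorem exists_ringHom_apply_eq_add (p : ℕ) [Fact p.Prime] (n : ℕ) :
    ∀ {L : Type*} [Field L] [CharP L p] {d : L} (_ : ∀ y : L, y ^ p ≠ d)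
      {S : Type*} [CommRing S] [CharP S p] (f : L →+* S) {t : S} (_ : t ^ p ^ n = 0),
      ∃ φ : L →+* S, φ d = f d + t ∧ ∀ a, φ a - f a ∈ Ideal.span {t} := by
  induction n with
  | zero =>
    intro L _ _ d _ S _ _ f t ht
    have ht : t = 0 := by simpa using ht
    exact ⟨f, by simp [ht], by simp⟩
  | succ n ih =>
    intro L _ _ d hd S _ _ f t ht
    have hp : p.Prime := Fact.out
    obtain ⟨M, hpow, hdM, htop⟩ := exists_subfield_adjoin_eq_top p hd
    have : CharP M p := (algebraMap M L).charP (algebraMap M L).injective p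
    let e : M := ⟨d ^ p, hpow d⟩
    have he : ∀ y : M, y ^ p ≠ e := fun y hy ↦ hdM <| by
      have : (y : L) ^ p = d ^ p := congrArg Subtype.val hy
      rw [← frobenius_inj L p this]
      exact y.2
    obtain ⟨φ, hφ, hφt⟩ := ih he (f.comp (algebraMap M L)) (t := t ^ p)
      (by rw [← pow_mul, ← pow_succ']; exact ht)
    have hirr : Irreducible (X ^ p - C e) := X_pow_sub_C_irreducible_of_prime hp he
    have : Fact (Irreducible (X ^ p - C e)) := ⟨hirr⟩
    let α : AdjoinRoot (X ^ p - C e) →+* L :=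
      AdjoinRoot.lift (algebraMap M L) d (by
        simp only [eval₂_sub, eval₂_X_pow, eval₂_C]
        exact sub_self _)
    have hα : Function.Bijective α := by
      refine ⟨α.injective, fun y ↦ ?_⟩
      have hy : y ∈ IntermediateField.adjoin M {d} := htop ▸ IntermediateField.mem_top
      induction hy using IntermediateField.adjoin_induction with
      | mem x hx =>
        obtain rfl : x = d := hx
        exact ⟨AdjoinRoot.root _, by simp [α]⟩
      | algebraMap x => exact ⟨AdjoinRoot.of _ x, by simp [α]⟩
      | add x y _ _ hx hy => exact α.range.add_mem hx hy
      | inv x _ hx => exact α.fieldRange.inv_mem hx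
      | mul x y _ _ hx hy => exact α.range.mul_mem hx hy
    let ε := RingEquiv.ofBijective α hα
    let β : AdjoinRoot (X ^ p - C e) →+* S := AdjoinRoot.lift φ (f d + t) (by
      rw [eval₂_sub, eval₂_X_pow, eval₂_C, hφ, add_pow_char, ← map_pow]
      exact sub_self _)
    have hεd : ε.symm d = AdjoinRoot.root _ := by
      rw [RingEquiv.symm_apply_eq]; simp [ε, α]
    have hβ (z) : β z - f (α z) ∈ Ideal.span {t} := by
      have : (Ideal.Quotient.mk (Ideal.span {t})).comp β =
          (Ideal.Quotient.mk (Ideal.span {t})).comp (f.comp α) := by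
        refine AdjoinRoot.ringHom_ext (RingHom.ext fun m ↦ ?_) ?_
        · simp only [RingHom.comp_apply]
          rw [Ideal.Quotient.eq]
          have := hφt m
          refine Ideal.span_singleton_le_span_singleton.2 (dvd_pow_self t hp.ne_zero) ?_
          simpa [β, α] using this
        · simp only [RingHom.comp_apply]
          rw [Ideal.Quotient.eq]
          simp [β, α]
      exact Ideal.Quotient.eq.1 (RingHom.congr_fun this z)
    refine ⟨β.comp ε.symm.toRingHom, ?_, fun a ↦ ?_⟩
    · simp [hεd, β]
    · have := hβ (ε.symm a)
      rwa [show α (ε.symm a) = a from ε.apply_symm_apply a] at this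

open Polynomial in
/-- If `k' / k` is a field extension whose elements have their `p ^ n`-th powers in `k`, and `k'`
contains all `p ^ n`-th roots of elements of `k`, then every `c ∉ k` is moved by some `k`-algebra
homomorphism from `k'` to an infinitesimal thickening of `k'`. -/
theorem exists_ringHom_apply_ne {k k' : Type*} [Field k] [Field k'] [Algebra k k'] (p : ℕ)
    [Fact p.Prime] [CharP k' p] (n : ℕ)
    (hpow : ∀ b : k', b ^ p ^ n ∈ (algebraMap k k').range)
    (hroot : ∀ a : k, ∃ b : k', b ^ p ^ n = algebraMap k k' a) {c : k'}
    (hc : c ∉ (algebraMap k k').range) :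
    ∃ (N : Ideal (AdjoinRoot (X ^ p ^ n : k'[X]))) (φ : k' →ₐ[k] AdjoinRoot (X ^ p ^ n : k'[X])),
      N ^ p ^ n = ⊥ ∧ (∀ a, φ a - algebraMap k' _ a ∈ N) ∧ φ c ≠ algebraMap k' _ c := by
  classical
  have hp : p.Prime := Fact.out
  have hne : p ^ n ≠ 0 := pow_ne_zero _ hp.ne_zero
  have hex : ∃ m, ∀ b : k', b ^ p ^ m ≠ c := ⟨n, fun b hb ↦ hc (hb ▸ hpow b)⟩
  obtain ⟨e, he⟩ : ∃ e, Nat.find hex = e + 1 := by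
    refine Nat.exists_eq_succ_of_ne_zero fun h ↦ ?_
    have := Nat.find_spec hex
    rw [h] at this
    exact this c (by simp)
  have hen : e < n := by
    have : Nat.find hex ≤ n := Nat.find_min' hex fun b hb ↦ hc (hb ▸ hpow b)
    omega
  obtain ⟨d, hdc⟩ : ∃ d : k', d ^ p ^ e = c := by
    simpa using Nat.find_min hex (m := e) (by omega)
  have hd (y : k') : y ^ p ≠ d := fun hy ↦ by
    have := Nat.find_spec hex
    rw [he] at this
    exact this y (by rw [pow_succ', pow_mul, hy, hdc])
  let S := AdjoinRoot (X ^ p ^ n : k'[X])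
  have : Nontrivial S := AdjoinRoot.nontrivial _ (by
    simpa using fun h : p = 0 ↦ absurd h hp.ne_zero)
  have : CharP S p := charP_of_injective_algebraMap (algebraMap k' S).injective p
  let t : S := AdjoinRoot.root _
  have ht_mk : t = AdjoinRoot.mk _ X := AdjoinRoot.mk_X.symm
  have ht : t ^ p ^ n = 0 := by
    rw [ht_mk, ← map_pow, AdjoinRoot.mk_self]
  obtain ⟨φ, hφ, hφt⟩ := exists_ringHom_apply_eq_add p n hd (algebraMap k' S) ht
  refine ⟨Ideal.span {t}, ⟨φ, fun a ↦ ?_⟩, ?_, hφt, ?_⟩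
  · obtain ⟨b, hb⟩ := hroot a
    obtain ⟨z, hz⟩ := Ideal.mem_span_singleton'.1 (hφt b)
    have hz' : φ b = algebraMap k' S b + z * t := by rw [hz]; ring
    change φ (algebraMap k k' a) = _
    rw [IsScalarTower.algebraMap_apply k k' S, ← hb, map_pow, hz', add_pow_char_pow, mul_pow, ht,
      mul_zero, add_zero, map_pow]
  · rw [Ideal.span_singleton_pow, ht]; simp
  · change φ c ≠ _
    intro h
    rw [← hdc, map_pow, hφ, add_pow_char_pow, map_pow, add_eq_left, ht_mk, ← map_pow,
      AdjoinRoot.mk_eq_zero, pow_dvd_pow_iff X_ne_zero not_isUnit_X,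
      Nat.pow_le_pow_iff_right hp.one_lt] at h
    omega

section

open scoped TensorProduct

section FieldTensor

variable {k k' K : Type*} [Field k] [Field k'] [Field K] [Algebra k k'] [Algebra k K]

/-- An additive subgroup of `K ⊗[k] k'` which is stable under multiplication by `k'` and under a
set of `k`-linear endomorphisms of `k'` vanishing at `1` and with field of constants `k` is trivial
as soon as it meets `K ⊗[k] k` trivially. -/
theorem eq_bot_of_lTensor_stable (J : AddSubgroup (K ⊗[k] k')) (𝒟 : Set (k' →ₗ[k] k'))
    (hmul : ∀ c, ∀ x ∈ J, (LinearMap.mulLeft k c).lTensor K x ∈ J)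
    (hJ : ∀ D ∈ 𝒟, ∀ x ∈ J, D.lTensor K x ∈ J) (h_one : ∀ D ∈ 𝒟, D 1 = 0)
    (hconst : ∀ c, (∀ D ∈ 𝒟, D c = 0) → c ∈ (algebraMap k k').range)
    (h_left : ∀ a : K, a ⊗ₜ[k] (1 : k') ∈ J → a = 0) : J = ⊥ := by
  classical
  let b := Module.Basis.ofVectorSpace k K
  let E := TensorProduct.equivFinsuppOfBasisLeft (N := k') b
  have hE (T : k' →ₗ[k] k') (x : K ⊗[k] k') (i) : E (T.lTensor K x) i = T (E x i) := by
    induction x with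
    | zero => simp
    | add x y hx hy => simp [hx, hy]
    | tmul a c => simp [E]
  rw [eq_bot_iff]
  suffices ∀ r, ∀ x ∈ J, (E x).support.card = r → x = 0 from
    fun x hx ↦ this _ x hx rfl
  intro r
  induction r using Nat.strong_induction_on with
  | _ r ih =>
    intro x hx hr
    by_contra hx0
    obtain ⟨i, hi⟩ : ∃ i, E x i ≠ 0 := by
      by_contra! h
      exact hx0 (E.map_eq_zero_iff.1 (Finsupp.ext h))
    let y := (LinearMap.mulLeft k (E x i)⁻¹).lTensor K x
    have hyJ : y ∈ J := hmul _ x hx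
    have hyE (j) : E y j = (E x i)⁻¹ * E x j := hE _ x j
    have hyi : E y i = 1 := by rw [hyE, inv_mul_cancel₀ hi]
    have hDy (D) (hD : D ∈ 𝒟) : D.lTensor K y = 0 := by
      refine ih _ ?_ _ (hJ D hD y hyJ) rfl
      rw [← hr]
      refine Finset.card_lt_card ((Finset.ssubset_iff_of_subset fun j hj ↦ ?_).2 ⟨i, ?_, ?_⟩)
      · rw [Finsupp.mem_support_iff] at hj ⊢
        refine fun h ↦ hj ?_
        rw [hE, hyE, h, mul_zero, map_zero]
      · rwa [Finsupp.mem_support_iff]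
      · rw [Finsupp.notMem_support_iff, hE, hyi, h_one D hD]
    have hrange (j) : E y j ∈ (algebraMap k k').range :=
      hconst _ fun D hD ↦ by rw [← hE, hDy D hD]; simp
    choose a ha using hrange
    let z : K := ∑ j ∈ (E y).support, a j • b j
    have hyz : y = z ⊗ₜ 1 := by
      rw [← E.symm_apply_apply y, TensorProduct.equivFinsuppOfBasisLeft_symm_apply,
        Finsupp.sum, TensorProduct.sum_tmul]
      refine Finset.sum_congr rfl fun j _ ↦ ?_
      rw [TensorProduct.smul_tmul, ← ha j, Algebra.smul_def, mul_one]
    have hz : z = 0 := h_left z (hyz ▸ hyJ)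
    rw [hyz, hz, TensorProduct.zero_tmul] at hyi
    simp at hyi

/-- `K ⊗[k] -` applied to a `k'`-linear functional on a `k'`-algebra `S` sends the extension of an
ideal of `K ⊗[k] k'` into that ideal. -/
theorem lTensor_mem_of_mem_map {S : Type*} [CommRing S] [Algebra k S] [Algebra k' S]
    [IsScalarTower k k' S] (ℓ : S →ₗ[k'] k') (J : Ideal (K ⊗[k] k')) {x : K ⊗[k] S}
    (hx : x ∈ J.map (Algebra.TensorProduct.map (AlgHom.id k K) (IsScalarTower.toAlgHom k k' S))) :
    (ℓ.restrictScalars k).lTensor K x ∈ J := by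
  have key (z : K ⊗[k] S) (y : K ⊗[k] k') : (ℓ.restrictScalars k).lTensor K
      (z * Algebra.TensorProduct.map (AlgHom.id k K) (IsScalarTower.toAlgHom k k' S) y) =
      (ℓ.restrictScalars k).lTensor K z * y := by
    induction z with
    | zero => simp
    | add u v hu hv => rw [add_mul, map_add, hu, hv, map_add, add_mul]
    | tmul a s =>
      induction y with
      | zero => simp
      | add u v hu hv => rw [map_add, mul_add, map_add, hu, hv, mul_add]
      | tmul a' c =>
        have : ℓ (s * algebraMap k' S c) = ℓ s * c := by
          rw [mul_comm, ← Algebra.smul_def, map_smul, smul_eq_mul, mul_comm]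
        simp [this]
  suffices ∀ z, (ℓ.restrictScalars k).lTensor K (z * x) ∈ J by simpa using this 1
  induction hx using Submodule.span_induction with
  | mem x hx =>
    obtain ⟨y, hy, rfl⟩ := hx
    exact fun z ↦ key z y ▸ J.mul_mem_left _ hy
  | zero => simp
  | add x y _ _ hx hy => exact fun z ↦ by rw [mul_add, map_add]; exact J.add_mem (hx z) (hy z)
  | smul w x _ hx => exact fun z ↦ by rw [smul_eq_mul, ← mul_assoc]; exact hx _

variable (k k' K) in
/-- The kernel of the multiplication map `K ⊗[k] k' → K`, given by its generators. -/
def diagonalIdeal [Algebra k' K] : Ideal (K ⊗[k] k') :=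
  Ideal.span (Set.range fun c : k' ↦ algebraMap k' K c ⊗ₜ[k] (1 : k') - 1 ⊗ₜ c)

theorem eq_zero_of_tmul_one_mem_diagonalIdeal [Algebra k' K] [IsScalarTower k k' K] {a : K}
    (ha : a ⊗ₜ[k] (1 : k') ∈ diagonalIdeal k k' K) : a = 0 := by
  let μ : K ⊗[k] k' →ₐ[k] K :=
    Algebra.TensorProduct.lift (AlgHom.id k K) (IsScalarTower.toAlgHom k k' K)
      fun _ _ ↦ Commute.all _ _
  have hle : diagonalIdeal k k' K ≤ RingHom.ker μ := by
    rw [diagonalIdeal, Ideal.span_le]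
    rintro _ ⟨c, rfl⟩
    simp [μ]
  simpa [μ] using hle ha

/-- A `k`-algebra homomorphism from `k'` to an infinitesimal thickening `S` of `k'` shifts the adic
filtration of the diagonal ideal by a bounded amount. -/
theorem map_mem_map_diagonalIdeal_pow [Algebra k' K] {S : Type*} [CommRing S]
    [Algebra k S] [Algebra k' S] [IsScalarTower k k' S] {N : Ideal S} {q : ℕ} (hN : N ^ q = ⊥)
    (φ : k' →ₐ[k] S) (hφ : ∀ a, φ a - algebraMap k' S a ∈ N) (m : ℕ) {x : K ⊗[k] k'}
    (hx : x ∈ diagonalIdeal k k' K ^ (m + q)) :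
    Algebra.TensorProduct.map (AlgHom.id k K) φ x ∈ (diagonalIdeal k k' K ^ m).map
      (Algebra.TensorProduct.map (AlgHom.id k K) (IsScalarTower.toAlgHom k k' S)) := by
  have hle : (diagonalIdeal k k' K).map (Algebra.TensorProduct.map (AlgHom.id k K) φ) ≤
      (diagonalIdeal k k' K).map
        (Algebra.TensorProduct.map (AlgHom.id k K) (IsScalarTower.toAlgHom k k' S)) ⊔
      N.map (Algebra.TensorProduct.includeRight : S →ₐ[k] K ⊗[k] S) := by
    rw [Ideal.map_le_iff_le_comap]
    conv_lhs => rw [diagonalIdeal]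
    rw [Ideal.span_le]
    rintro _ ⟨c, rfl⟩
    have : Algebra.TensorProduct.map (AlgHom.id k K) φ
        (algebraMap k' K c ⊗ₜ[k] (1 : k') - 1 ⊗ₜ c) =
        Algebra.TensorProduct.map (AlgHom.id k K) (IsScalarTower.toAlgHom k k' S)
          (algebraMap k' K c ⊗ₜ[k] (1 : k') - 1 ⊗ₜ c) -
        Algebra.TensorProduct.includeRight (φ c - algebraMap k' S c) := by
      simp [TensorProduct.tmul_sub]
    rw [SetLike.mem_coe, Ideal.mem_comap, this]
    exact Ideal.sub_mem _ (Ideal.mem_sup_left <| Ideal.mem_map_of_mem _ <|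
      Ideal.subset_span ⟨c, rfl⟩) (Ideal.mem_sup_right <| Ideal.mem_map_of_mem _ (hφ c))
  have h := Ideal.mem_map_of_mem (Algebra.TensorProduct.map (AlgHom.id k K) φ) hx
  rw [Ideal.map_pow] at h
  have h' := Ideal.sup_pow_add_le_pow_sup_pow (Ideal.pow_right_mono hle _ h)
  rwa [← Ideal.map_pow, ← Ideal.map_pow, hN, Ideal.map_bot, sup_bot_eq] at h'

/-- The diagonal ideal of `K ⊗[k] k'` is separated if `k' = k ^ (1 / p ^ n)`. -/
theorem iInf_diagonalIdeal_pow_eq_bot [Algebra k' K] [IsScalarTower k k' K] (p : ℕ)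
    [Fact p.Prime] [CharP k' p] (n : ℕ)
    (hpow : ∀ b : k', b ^ p ^ n ∈ (algebraMap k k').range)
    (hroot : ∀ a : k, ∃ b : k', b ^ p ^ n = algebraMap k k' a) :
    ⨅ m, diagonalIdeal k k' K ^ m = ⊥ := by
  let J : Ideal (K ⊗[k] k') := ⨅ m, diagonalIdeal k k' K ^ m
  suffices J.toAddSubgroup = ⊥ from Submodule.toAddSubgroup_injective this
  refine eq_bot_of_lTensor_stable J.toAddSubgroup
    {D | D 1 = 0 ∧ ∀ x ∈ J, D.lTensor K x ∈ J} (fun c x hx ↦ ?_) (fun D hD ↦ hD.2)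
    (fun D hD ↦ hD.1) (fun c h ↦ ?_) (fun a ha ↦ ?_)
  · have : (LinearMap.mulLeft k c).lTensor K x = (1 ⊗ₜ c) * x := by
      clear hx
      induction x with
      | zero => simp
      | add x y hx hy => rw [map_add, hx, hy, mul_add]
      | tmul a b => simp
    rw [this]
    exact J.mul_mem_left _ hx
  · by_contra hc
    obtain ⟨N, φ, hN, hφ, hne⟩ := exists_ringHom_apply_ne p n hpow hroot hc
    set S := AdjoinRoot (Polynomial.X ^ p ^ n : Polynomial k')
    refine hne (sub_eq_zero.1 ((Module.forall_dual_apply_eq_zero_iff k' _).1 fun ℓ ↦ ?_))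
    let D : k' →ₗ[k] k' := ℓ.restrictScalars k ∘ₗ
      (φ.toLinearMap - (IsScalarTower.toAlgHom k k' S).toLinearMap)
    refine h D ⟨by simp [D], fun x hx ↦ Ideal.mem_iInf.2 fun m ↦ ?_⟩
    have hD : D.lTensor K x = (ℓ.restrictScalars k).lTensor K
        (Algebra.TensorProduct.map (AlgHom.id k K) φ x) - (ℓ.restrictScalars k).lTensor K
        (Algebra.TensorProduct.map (AlgHom.id k K) (IsScalarTower.toAlgHom k k' S) x) := by
      clear hx
      induction x with
      | zero => simp
      | add x y hx hy => rw [map_add, hx, hy]; simp only [map_add]; abel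
      | tmul a b => simp [D, TensorProduct.tmul_sub]
    rw [hD]
    exact Ideal.sub_mem _
      (lTensor_mem_of_mem_map ℓ _
        (map_mem_map_diagonalIdeal_pow hN φ hφ m (Ideal.mem_iInf.1 hx _)))
      (lTensor_mem_of_mem_map ℓ _ (Ideal.mem_map_of_mem _ (Ideal.mem_iInf.1 hx _)))
  · exact eq_zero_of_tmul_one_mem_diagonalIdeal (by simpa using Ideal.mem_iInf.1 ha 1)

/-- The extension of the diagonal ideal to `K ⊗[k] L` is separated if `k' = k ^ (1 / p ^ n)`. -/
theorem iInf_map_diagonalIdeal_pow_eq_bot {L : Type*} [CommRing L] [Algebra k L] [Algebra k' L]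
    [IsScalarTower k k' L] [Algebra k' K] [IsScalarTower k k' K] (p : ℕ)
    [Fact p.Prime] [CharP k' p] (n : ℕ)
    (hpow : ∀ b : k', b ^ p ^ n ∈ (algebraMap k k').range)
    (hroot : ∀ a : k, ∃ b : k', b ^ p ^ n = algebraMap k k' a) :
    ⨅ m, (diagonalIdeal k k' K).map
      (Algebra.TensorProduct.map (AlgHom.id k K) (IsScalarTower.toAlgHom k k' L)) ^ m = ⊥ := by
  classical
  rw [eq_bot_iff]
  intro x hx
  let b := Module.Basis.ofVectorSpace k K
  let E := TensorProduct.equivFinsuppOfBasisLeft (N := L) b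
  let E' := TensorProduct.equivFinsuppOfBasisLeft (N := k') b
  have hE (ℓ : L →ₗ[k'] k') (x : K ⊗[k] L) (i) :
      E' ((ℓ.restrictScalars k).lTensor K x) i = ℓ (E x i) := by
    induction x with
    | zero => simp
    | add x y hx hy => simp [hx, hy]
    | tmul a c =>
      simp only [LinearMap.lTensor_tmul, LinearMap.coe_restrictScalars, E, E',
        TensorProduct.equivFinsuppOfBasisLeft_apply_tmul, Finsupp.mapRange_apply]
      exact ((ℓ.restrictScalars k).map_smul _ _).symm
  refine E.map_eq_zero_iff.1 (Finsupp.ext fun i ↦ ?_)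
  refine (Module.forall_dual_apply_eq_zero_iff k' _).1 fun ℓ ↦ ?_
  have : (ℓ.restrictScalars k).lTensor K x ∈ ⨅ m, diagonalIdeal k k' K ^ m :=
    Ideal.mem_iInf.2 fun m ↦ lTensor_mem_of_mem_map ℓ _ (by
      rw [Ideal.map_pow]; exact Ideal.mem_iInf.1 hx m)
  rw [iInf_diagonalIdeal_pow_eq_bot p n hpow hroot, Ideal.mem_bot] at this
  rw [← hE, this]
  simp

/-- If `K` and `L` are perfect extensions of `k` and `k' = k ^ (1 / p ^ n)`, then an element of
`K ⊗[k] L` killed by the `n`-th power of Frobenius lies in the extension of the diagonal ideal. -/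
theorem mem_map_diagonalIdeal_of_pow_eq_zero {L : Type*} [Field L] [Algebra k L] [Algebra k' L]
    [IsScalarTower k k' L] [Algebra k' K] [IsScalarTower k k' K] (p : ℕ)
    [Fact p.Prime] [CharP K p] [CharP L p] [PerfectRing K p] [PerfectRing L p] (n : ℕ)
    (hroot : ∀ a : k, ∃ b : k', b ^ p ^ n = algebraMap k k' a) {x : K ⊗[k] L}
    (hx : x ^ p ^ n = 0) :
    x ∈ (diagonalIdeal k k' K).map
      (Algebra.TensorProduct.map (AlgHom.id k K) (IsScalarTower.toAlgHom k k' L)) := by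
  set 𝔨 := (diagonalIdeal k k' K).map
      (Algebra.TensorProduct.map (AlgHom.id k K) (IsScalarTower.toAlgHom k k' L))
  have hgen (c : k') : algebraMap k' K c ⊗ₜ[k] (1 : L) - 1 ⊗ₜ algebraMap k' L c ∈ 𝔨 := by
    have : algebraMap k' K c ⊗ₜ[k] (1 : k') - 1 ⊗ₜ c ∈ diagonalIdeal k k' K :=
      Ideal.subset_span ⟨c, rfl⟩
    simpa using Ideal.mem_map_of_mem
      (Algebra.TensorProduct.map (AlgHom.id k K) (IsScalarTower.toAlgHom k k' L)) this
  let u := (iterateFrobeniusEquiv K p n).symm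
  let v := (iterateFrobeniusEquiv L p n).symm
  have hu (r : k) (c : k') (h : c ^ p ^ n = algebraMap k k' r) :
      u (algebraMap k K r) = algebraMap k' K c := by
    rw [RingEquiv.symm_apply_eq, iterateFrobeniusEquiv_apply, iterateFrobenius_def, ← map_pow, h,
      ← IsScalarTower.algebraMap_apply]
  have hv (r : k) (c : k') (h : c ^ p ^ n = algebraMap k k' r) :
      v (algebraMap k L r) = algebraMap k' L c := by
    rw [RingEquiv.symm_apply_eq, iterateFrobeniusEquiv_apply, iterateFrobenius_def, ← map_pow, h,
      ← IsScalarTower.algebraMap_apply]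
  let f : K →+ L →+ K ⊗[k] L ⧸ 𝔨 := AddMonoidHom.mk' (fun a ↦ AddMonoidHom.mk'
    (fun b ↦ Ideal.Quotient.mk 𝔨 (u a ⊗ₜ v b))
    (fun b b' ↦ by rw [map_add, TensorProduct.tmul_add, map_add]))
    (fun a a' ↦ by ext b; simp [TensorProduct.add_tmul])
  have hf (r : k) (a : K) (b : L) : f (r • a) b = f a (r • b) := by
    obtain ⟨c, hc⟩ := hroot r
    refine Ideal.Quotient.eq.2 ?_
    rw [Algebra.smul_def, Algebra.smul_def, map_mul, map_mul, hu r c hc, hv r c hc]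
    convert 𝔨.mul_mem_right (u a ⊗ₜ v b) (hgen c) using 1
    simp [sub_mul]
  let ψ := TensorProduct.liftAddHom f hf
  have : CharP (K ⊗[k] L) p := charP_of_injective_algebraMap (algebraMap K (K ⊗[k] L)).injective p
  have hψ (y : K ⊗[k] L) : ψ (y ^ p ^ n) = Ideal.Quotient.mk 𝔨 y := by
    induction y with
    | zero => simp [(Fact.out : p.Prime).ne_zero]
    | add y z hy hz => rw [add_pow_char_pow, map_add, hy, hz, map_add]
    | tmul a b =>
      rw [Algebra.TensorProduct.tmul_pow]
      change Ideal.Quotient.mk 𝔨 (u (a ^ p ^ n) ⊗ₜ v (b ^ p ^ n)) = _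
      congr 2
      · exact (iterateFrobeniusEquiv K p n).symm_apply_apply a
      · exact (iterateFrobeniusEquiv L p n).symm_apply_apply b
  rw [← Ideal.Quotient.eq_zero_iff_mem, ← hψ, hx, map_zero]

end FieldTensor

theorem map_frobeniusPowerKernel_le (p : ℕ) {A T : Type*} [CommRing A] [CommRing T] (g : A →+* T)
    (n : ℕ) : (frobeniusPowerKernel p A n).map g ≤ frobeniusPowerKernel p T n := by
  rw [frobeniusPowerKernel, Ideal.map_span, Ideal.span_le]
  rintro _ ⟨x, hx, rfl⟩
  refine Ideal.subset_span ?_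
  rw [Set.mem_ofPred_eq, ← map_pow, hx, map_zero]

/-- A ring is Frobenius separated if it admits a jointly injective family of homomorphisms to
Frobenius separated rings. -/
theorem IsFrobeniusSeparated.of_jointly_injective {p : ℕ} {A ι : Type*} [CommRing A]
    {T : ι → Type*} [∀ i, CommRing (T i)] (hT : ∀ i, IsFrobeniusSeparated p (T i))
    (g : ∀ i, A →+* T i) (hg : ∀ x, (∀ i, g i x = 0) → x = 0) : IsFrobeniusSeparated p A := by
  refine fun n hn ↦ eq_bot_iff.2 fun x hx ↦ hg x fun i ↦ ?_
  rw [← Ideal.mem_bot, ← hT i n hn]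
  simp only [Ideal.mem_iInf] at hx ⊢
  refine fun m hm ↦ Ideal.pow_right_mono (map_frobeniusPowerKernel_le p (g i) n) m ?_
  rw [← Ideal.map_pow]
  exact Ideal.mem_map_of_mem _ (hx m hm)

/-- The field `k`, to be regarded as the extension `k ^ (1 / p ^ n)` of `k` through the `n`-th power
of Frobenius. -/
def FrobeniusTwist (k : Type*) : Type _ := k

noncomputable instance (k : Type*) [Field k] : Field (FrobeniusTwist k) := inferInstanceAs (Field k)

theorem isFrobeniusSeparated_tensorProduct_of_perfect {k K L : Type*} [Field k] [Field K] [Field L]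
    [Algebra k K] [Algebra k L] (p : ℕ) [Fact p.Prime] [CharP k p] [CharP K p] [CharP L p]
    [PerfectRing K p] [PerfectRing L p] : IsFrobeniusSeparated p (K ⊗[k] L) := by
  intro n _
  have : CharP (FrobeniusTwist k) p := inferInstanceAs (CharP k p)
  let : Algebra k (FrobeniusTwist k) := (iterateFrobenius k p n).toAlgebra
  let : Algebra (FrobeniusTwist k) K :=
    ((iterateFrobeniusEquiv K p n).symm.toRingHom.comp (algebraMap k K)).toAlgebra
  let : Algebra (FrobeniusTwist k) L :=
    ((iterateFrobeniusEquiv L p n).symm.toRingHom.comp (algebraMap k L)).toAlgebra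
  have hK : IsScalarTower k (FrobeniusTwist k) K := .of_algebraMap_eq fun a ↦ by
    refine ((iterateFrobeniusEquiv K p n).symm_apply_eq.2 ?_).symm
    exact map_pow (algebraMap k K) a _
  have hL : IsScalarTower k (FrobeniusTwist k) L := .of_algebraMap_eq fun a ↦ by
    refine ((iterateFrobeniusEquiv L p n).symm_apply_eq.2 ?_).symm
    exact map_pow (algebraMap k L) a _
  have hroot (a : k) : ∃ b : FrobeniusTwist k, b ^ p ^ n = algebraMap k (FrobeniusTwist k) a :=
    ⟨a, rfl⟩
  have hpow (b : FrobeniusTwist k) : b ^ p ^ n ∈ (algebraMap k (FrobeniusTwist k)).range :=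
    ⟨b, rfl⟩
  have hle : frobeniusPowerKernel p (K ⊗[k] L) n ≤ (diagonalIdeal k (FrobeniusTwist k) K).map
      (Algebra.TensorProduct.map (AlgHom.id k K)
        (IsScalarTower.toAlgHom k (FrobeniusTwist k) L)) :=
    Ideal.span_le.2 fun x hx ↦ mem_map_diagonalIdeal_of_pow_eq_zero p n hroot hx
  refine eq_bot_iff.2 fun x hx ↦ ?_
  rw [← iInf_map_diagonalIdeal_pow_eq_bot (K := K) (L := L) p n hpow hroot, Ideal.mem_iInf]
  intro m
  simp only [Ideal.mem_iInf] at hx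
  exact Ideal.pow_right_mono hle m (Ideal.pow_le_pow_right m.le_succ (hx (m + 1) m.succ_pos))

theorem eq_zero_of_lTensor_eq_zero {k V M ι : Type*} [Field k] [AddCommGroup V] [Module k V]
    [AddCommGroup M] [Module k M] {T : ι → Type*} [∀ i, AddCommGroup (T i)] [∀ i, Module k (T i)]
    (g : ∀ i, M →ₗ[k] T i) (hg : ∀ y, (∀ i, g i y = 0) → y = 0) {x : V ⊗[k] M}
    (hx : ∀ i, (g i).lTensor V x = 0) : x = 0 := by
  classical
  let b := Module.Basis.ofVectorSpace k V
  have hE (i) (x : V ⊗[k] M) (j) : TensorProduct.equivFinsuppOfBasisLeft b ((g i).lTensor V x) j =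
      g i (TensorProduct.equivFinsuppOfBasisLeft b x j) := by
    induction x with
    | zero => simp
    | add x y hx hy => simp [hx, hy]
    | tmul a c => simp
  refine (TensorProduct.equivFinsuppOfBasisLeft b).map_eq_zero_iff.1 (Finsupp.ext fun j ↦ ?_)
  exact hg _ fun i ↦ by rw [← hE, hx]; simp

theorem eq_zero_of_rTensor_eq_zero {k V M ι : Type*} [Field k] [AddCommGroup V] [Module k V]
    [AddCommGroup M] [Module k M] {T : ι → Type*} [∀ i, AddCommGroup (T i)] [∀ i, Module k (T i)]
    (g : ∀ i, M →ₗ[k] T i) (hg : ∀ y, (∀ i, g i y = 0) → y = 0) {x : M ⊗[k] V}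
    (hx : ∀ i, (g i).rTensor V x = 0) : x = 0 := by
  refine (TensorProduct.comm k M V).map_eq_zero_iff.1 (eq_zero_of_lTensor_eq_zero g hg fun i ↦ ?_)
  rw [← LinearMap.comm_comp_rTensor_comp_comm_eq]
  simp [hx]

theorem eq_zero_of_forall_algebraMap_algebraicClosure_residueField_eq_zero {A : Type*} [CommRing A]
    [IsReduced A] {a : A}
    (h : ∀ P : PrimeSpectrum A, algebraMap A (AlgebraicClosure P.asIdeal.ResidueField) a = 0) :
    a = 0 := by
  rw [← isNilpotent_iff_eq_zero, ← mem_nilradical, nilradical_eq_sInf, Ideal.mem_sInf]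
  intro P hP
  have : P.IsPrime := hP
  rw [← Ideal.algebraMap_residueField_eq_zero]
  have := h ⟨P, hP⟩
  rwa [IsScalarTower.algebraMap_apply A P.ResidueField, map_eq_zero] at this

theorem isFrobeniusSeparated_tensorProduct_of_isReduced {k D E : Type*} [Field k] [CommRing D]
    [CommRing E] [Algebra k D] [Algebra k E] [IsReduced D] [IsReduced E] (p : ℕ) [Fact p.Prime]
    [CharP k p] : IsFrobeniusSeparated p (D ⊗[k] E) := by
  let F (P : PrimeSpectrum D) := AlgebraicClosure P.asIdeal.ResidueField
  let G (Q : PrimeSpectrum E) := AlgebraicClosure Q.asIdeal.ResidueField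
  have hF (P) : CharP (F P) p := charP_of_injective_algebraMap (algebraMap k (F P)).injective p
  have hG (Q) : CharP (G Q) p := charP_of_injective_algebraMap (algebraMap k (G Q)).injective p
  let f (P) : D →ₐ[k] F P := IsScalarTower.toAlgHom k D (F P)
  let g (Q) : E →ₐ[k] G Q := IsScalarTower.toAlgHom k E (G Q)
  refine .of_jointly_injective (T := fun i : PrimeSpectrum D × PrimeSpectrum E ↦ F i.1 ⊗[k] G i.2)
    (fun i ↦ isFrobeniusSeparated_tensorProduct_of_perfect p)
    (fun i ↦ (Algebra.TensorProduct.map (f i.1) (g i.2)).toRingHom) fun x hx ↦ ?_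
  refine eq_zero_of_rTensor_eq_zero (fun P ↦ (f P).toLinearMap)
    (fun y hy ↦ eq_zero_of_forall_algebraMap_algebraicClosure_residueField_eq_zero hy) fun P ↦ ?_
  refine eq_zero_of_lTensor_eq_zero (fun Q ↦ (g Q).toLinearMap)
    (fun y hy ↦ eq_zero_of_forall_algebraMap_algebraicClosure_residueField_eq_zero hy) fun Q ↦ ?_
  rw [← LinearMap.comp_apply, LinearMap.lTensor_comp_rTensor]
  exact hx (P, Q)

theorem exists_pow_eq_bot_isFrobeniusSeparated_quotient {k D : Type*} [Field k] [CommRing D]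
    [Algebra k D] (p : ℕ) [Fact p.Prime] [CharP k p] {e : ℕ} (he : nilradical D ^ e = ⊥) :
    ∃ 𝔟 : Ideal (D ⊗[k] D), 𝔟 ^ (e + e) = ⊥ ∧ IsFrobeniusSeparated p (D ⊗[k] D ⧸ 𝔟) := by
  have : IsReduced (D ⧸ nilradical D) :=
    (Ideal.isRadical_iff_quotient_reduced _).1 (Ideal.radical_isRadical _)
  let π : D →ₐ[k] D ⧸ nilradical D := Ideal.Quotient.mkₐ k (nilradical D)
  have hπ : Function.Surjective π := Ideal.Quotient.mkₐ_surjective k _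
  have hker : RingHom.ker π = nilradical D := Ideal.Quotient.mkₐ_ker k _
  refine ⟨RingHom.ker (Algebra.TensorProduct.map π π), ?_, ?_⟩
  · rw [Algebra.TensorProduct.map_ker π π hπ hπ, hker, eq_bot_iff]
    refine Ideal.sup_pow_add_le_pow_sup_pow.trans ?_
    rw [← Ideal.map_pow, ← Ideal.map_pow, he, Ideal.map_bot, Ideal.map_bot, sup_bot_eq]
  · exact .of_jointly_injective (ι := Unit)
      (fun _ ↦ isFrobeniusSeparated_tensorProduct_of_isReduced (k := k) p)
      (fun _ ↦ RingHom.kerLift (Algebra.TensorProduct.map π π).toRingHom)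
      fun x hx ↦ (injective_iff_map_eq_zero _).1 (RingHom.kerLift_injective _) x (hx ())

/-- Let `𝔭` be a minimal prime. If `b` becomes nilpotent in the fibre over `𝔭`, then some multiple
of `b` by an element outside `𝔭` is nilpotent. -/
theorem exists_isNilpotent_smul_of_isNilpotent_tmul {R B : Type*} [CommRing R] [CommRing B]
    [Algebra R B] {𝔭 : Ideal R} [𝔭.IsPrime] (h𝔭 : 𝔭 ∈ minimalPrimes R) {b : B}
    (hb : IsNilpotent ((1 : 𝔭.ResidueField) ⊗ₜ[R] b)) : ∃ u ∉ 𝔭, IsNilpotent (u • b) := by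
  by_contra! h
  have hdisj : Disjoint ((⊥ : Ideal B) : Set B)
      ((𝔭.primeCompl.map (algebraMap R B) ⊔ Submonoid.powers b : Submonoid B) : Set B) := by
    rw [Set.disjoint_left]
    rintro x hx hx'
    obtain ⟨_, ⟨u, hu, rfl⟩, _, ⟨m, rfl⟩, rfl⟩ := Submonoid.mem_sup.1 hx'
    refine h u hu ⟨m + 1, ?_⟩
    have hx : algebraMap R B u * b ^ m = 0 := hx
    rw [Algebra.smul_def, mul_pow, pow_succ, pow_succ]
    linear_combination (algebraMap R B u ^ m * b) * hx
  obtain ⟨Q, hQ, -, hdisjQ⟩ := Ideal.exists_le_prime_disjoint _ _ hdisj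
  rw [Set.disjoint_left] at hdisjQ
  have hle : Q.comap (algebraMap R B) ≤ 𝔭 := fun u hu ↦ by
    by_contra hu'
    exact hdisjQ hu (Submonoid.mem_sup_left ⟨u, hu', rfl⟩)
  have heq : 𝔭 = Q.comap (algebraMap R B) :=
    le_antisymm (h𝔭.2 ⟨Ideal.comap_isPrime _ _, bot_le⟩ hle) hle
  let f : 𝔭.ResidueField →ₐ[R] Q.ResidueField :=
    Ideal.ResidueField.mapₐ 𝔭 Q (Algebra.ofId R B) heq
  let F : 𝔭.ResidueField ⊗[R] B →ₐ[R] Q.ResidueField :=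
    Algebra.TensorProduct.lift f (IsScalarTower.toAlgHom R B Q.ResidueField)
      fun _ _ ↦ Commute.all _ _
  have hF := (hb.map F).eq_zero
  have : algebraMap B Q.ResidueField b = 0 := by simpa [F] using hF
  rw [Ideal.algebraMap_residueField_eq_zero] at this
  exact hdisjQ this (Submonoid.mem_sup_right (Submonoid.mem_powers b))

theorem exists_smul_eq_one_tmul {R B : Type*} [CommRing R] [CommRing B] [Algebra R B]
    (𝔭 : Ideal R) [𝔭.IsPrime] (y : 𝔭.ResidueField ⊗[R] B) :
    ∃ s ∉ 𝔭, ∃ b : B, s • y = 1 ⊗ₜ b := by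
  induction y with
  | zero => exact ⟨1, (Ideal.ne_top_iff_one _).1 Ideal.IsPrime.ne_top', 0, by simp⟩
  | add x y hx hy =>
    obtain ⟨s, hs, b, hb⟩ := hx
    obtain ⟨t, ht, c, hc⟩ := hy
    refine ⟨s * t, fun h ↦ (Ideal.IsPrime.mem_or_mem ‹_› h).elim hs ht, t • b + s • c, ?_⟩
    rw [smul_add, mul_comm, mul_smul, hb, mul_comm, mul_smul, hc, TensorProduct.tmul_add,
      TensorProduct.tmul_smul, TensorProduct.tmul_smul]
  | tmul a b =>
    obtain ⟨r, s, hs, rfl⟩ := IsFractionRing.div_surjective (A := R ⧸ 𝔭) a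
    obtain ⟨r, rfl⟩ := Ideal.Quotient.mk_surjective r
    obtain ⟨s, rfl⟩ := Ideal.Quotient.mk_surjective s
    have hs' : s ∉ 𝔭 := fun h ↦
      nonZeroDivisors.ne_zero hs (Ideal.Quotient.eq_zero_iff_mem.2 h)
    refine ⟨s, hs', r • b, ?_⟩
    rw [TensorProduct.tmul_smul, TensorProduct.smul_tmul', TensorProduct.smul_tmul']
    congr 1
    have hs0 : algebraMap R 𝔭.ResidueField s ≠ 0 := by
      rwa [Ne, Ideal.algebraMap_residueField_eq_zero]
    rw [Algebra.smul_def, Algebra.smul_def, mul_one, Ideal.algebraMap_quotient_residueField_mk,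
      Ideal.algebraMap_quotient_residueField_mk, mul_div_cancel₀ _ hs0]

/-- The nilradical of the fibre over a minimal prime is generated by the nilradical. -/
theorem nilradical_residueField_tensorProduct_le {R B : Type*} [CommRing R] [CommRing B]
    [Algebra R B] {𝔭 : Ideal R} [𝔭.IsPrime] (h𝔭 : 𝔭 ∈ minimalPrimes R) :
    nilradical (𝔭.ResidueField ⊗[R] B) ≤ (nilradical B).map
      (Algebra.TensorProduct.includeRight : B →ₐ[R] 𝔭.ResidueField ⊗[R] B) := by
  intro y hy
  obtain ⟨s, hs, b, hb⟩ := exists_smul_eq_one_tmul 𝔭 y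
  have hb' : IsNilpotent ((1 : 𝔭.ResidueField) ⊗ₜ[R] b) := hb ▸ (mem_nilradical.1 hy).smul s
  obtain ⟨u, hu, hub⟩ := exists_isNilpotent_smul_of_isNilpotent_tmul h𝔭 hb'
  have hus : algebraMap R 𝔭.ResidueField (u * s) ≠ 0 := by
    rw [Ne, Ideal.algebraMap_residueField_eq_zero]
    exact fun h ↦ (Ideal.IsPrime.mem_or_mem ‹_› h).elim hu hs
  have key : y = (algebraMap R 𝔭.ResidueField (u * s))⁻¹ • ((1 : 𝔭.ResidueField) ⊗ₜ[R] (u • b)) := by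
    rw [eq_inv_smul_iff₀ hus, algebraMap_smul, mul_smul, hb, TensorProduct.tmul_smul]
  rw [key, Algebra.smul_def]
  exact Ideal.mul_mem_left _ _ (Ideal.mem_map_of_mem _ (mem_nilradical.2 hub))

/-- An element of a flat algebra over a Noetherian ring which vanishes in the fibres over all
minimal primes lies in the ideal generated by the nilradical of the base. -/
theorem mem_map_nilradical_of_forall_tmul_eq_zero {R C : Type*} [CommRing R] [IsNoetherianRing R]
    [CommRing C] [Algebra R C] [Module.Flat R C] {x : C}
    (hx : ∀ 𝔭 : Ideal R, ∀ [𝔭.IsPrime], 𝔭 ∈ minimalPrimes R →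
      (1 : 𝔭.ResidueField) ⊗ₜ[R] x = 0) : x ∈ (nilradical R).map (algebraMap R C) := by
  classical
  have : Finite (minimalPrimes R) := minimalPrimes.finite_of_isNoetherianRing R
  have := Fintype.ofFinite (minimalPrimes R)
  have hprime (𝔭 : minimalPrimes R) : 𝔭.1.IsPrime := 𝔭.2.1.1
  let f : R →ₗ[R] ∀ 𝔭 : minimalPrimes R, 𝔭.1.ResidueField :=
    LinearMap.pi fun 𝔭 ↦ Algebra.linearMap R 𝔭.1.ResidueField
  have hker : LinearMap.ker f = nilradical R := by
    ext r
    rw [nilradical, ← Ideal.sInf_minimalPrimes, Ideal.mem_sInf]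
    simp only [LinearMap.mem_ker, funext_iff]
    exact ⟨fun h 𝔭 h𝔭 ↦ by
        have := hprime ⟨𝔭, h𝔭⟩
        exact Ideal.algebraMap_residueField_eq_zero.1 (h ⟨𝔭, h𝔭⟩),
      fun h 𝔭 ↦ Ideal.algebraMap_residueField_eq_zero.2 (h 𝔭.2)⟩
  have hexact := Module.Flat.lTensor_exact C (LinearMap.exact_subtype_ker_map f)
  have h0 : f.lTensor C (x ⊗ₜ 1) = 0 := by
    refine (TensorProduct.piRight R R C _).map_eq_zero_iff.1 (funext fun 𝔭 ↦ ?_)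
    have := congrArg (TensorProduct.comm R _ C) (hx 𝔭.1 𝔭.2)
    simpa [f] using this
  obtain ⟨z, hz⟩ := (hexact _).1 h0
  have hmem : ∀ z, TensorProduct.rid R C ((LinearMap.ker f).subtype.lTensor C z) ∈
      (nilradical R).map (algebraMap R C) := by
    intro z
    induction z with
    | zero => simp
    | add z w hz hw => rw [map_add, map_add]; exact Ideal.add_mem _ hz hw
    | tmul c r =>
      rw [LinearMap.lTensor_tmul, TensorProduct.rid_tmul, Algebra.smul_def]
      exact Ideal.mul_mem_right _ _ (Ideal.mem_map_of_mem _ (hker ▸ r.2))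
  simpa [hz] using hmem z

/-- The canonical homomorphism from `B ⊗[R] B` to the self tensor product of a base change. -/
noncomputable def tensorSelfBaseChange (R B κ : Type*) [CommRing R] [CommRing B] [Algebra R B]
    [CommRing κ] [Algebra R κ] : B ⊗[R] B →ₐ[R] (κ ⊗[R] B) ⊗[κ] (κ ⊗[R] B) :=
  Algebra.TensorProduct.lift
    (((Algebra.TensorProduct.includeLeft :
      κ ⊗[R] B →ₐ[κ] (κ ⊗[R] B) ⊗[κ] (κ ⊗[R] B)).restrictScalars R).comp
      Algebra.TensorProduct.includeRight)
    (((Algebra.TensorProduct.includeRight :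
      κ ⊗[R] B →ₐ[κ] (κ ⊗[R] B) ⊗[κ] (κ ⊗[R] B)).restrictScalars R).comp
      Algebra.TensorProduct.includeRight)
    fun _ _ ↦ Commute.all _ _

theorem one_tmul_eq_zero_of_tensorSelfBaseChange_eq_zero {R B κ : Type*} [CommRing R] [CommRing B]
    [Algebra R B] [CommRing κ] [Algebra R κ] {x : B ⊗[R] B}
    (hx : tensorSelfBaseChange R B κ x = 0) : (1 : κ) ⊗ₜ[R] x = 0 := by
  refine (TensorProduct.AlgebraTensorModule.distribBaseChange R κ B B).map_eq_zero_iff.1 ?_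
  rw [← hx]
  clear hx
  induction x with
  | zero => simp
  | add x y hx hy => rw [TensorProduct.tmul_add, map_add, hx, hy, map_add]
  | tmul a b => simp [tensorSelfBaseChange]

end

open scoped TensorProduct in
/-- Corollary C.7: for `R` Noetherian with `p` nilpotent and `B` a flat `R`-algebra
with nilpotent nilradical, `B ⊗_R B` is almost Frobenius separated. -/
theorem isAlmostFrobeniusSeparated_tensor_self
    (p : ℕ) (hp : p.Prime) (R : Type*) [CommRing R] [IsNoetherianRing R]
    (hpR : IsNilpotent (p : R))
    (B : Type*) [CommRing B] [Algebra R B] [Module.Flat R B]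
    (hnil : IsNilpotent (nilradical B)) :
    IsAlmostFrobeniusSeparated p (B ⊗[R] B) := by
  have : Fact p.Prime := ⟨hp⟩
  obtain ⟨e, he⟩ := hnil
  have hchar (𝔭 : Ideal R) [𝔭.IsPrime] : CharP 𝔭.ResidueField p := by
    rw [CharP.charP_iff_prime_eq_zero hp]
    simpa using (hpR.map (algebraMap R 𝔭.ResidueField)).eq_zero
  have hprime (𝔭 : minimalPrimes R) : 𝔭.1.IsPrime := 𝔭.2.1.1
  have hD (𝔭 : minimalPrimes R) : nilradical (𝔭.1.ResidueField ⊗[R] B) ^ e = ⊥ := by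
    refine eq_bot_iff.2
      ((Ideal.pow_right_mono (nilradical_residueField_tensorProduct_le 𝔭.2) e).trans ?_)
    rw [← Ideal.map_pow, he, Ideal.zero_eq_bot, Ideal.map_bot]
  choose 𝔟 h𝔟 hFs using fun 𝔭 ↦
    exists_pow_eq_bot_isFrobeniusSeparated_quotient (k := 𝔭.1.ResidueField) p (hD 𝔭)
  let h (𝔭 : minimalPrimes R) := (tensorSelfBaseChange R B 𝔭.1.ResidueField).toRingHom
  let 𝔞 : Ideal (B ⊗[R] B) := ⨅ 𝔭, (𝔟 𝔭).comap (h 𝔭)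
  have h𝔞 (𝔭) : 𝔞 ≤ (𝔟 𝔭).comap (h 𝔭) := iInf_le _ 𝔭
  refine ⟨𝔞, ?_, ?_, ?_⟩
  · have hle : 𝔞 ^ (e + e) ≤ (nilradical R).map (algebraMap R (B ⊗[R] B)) := fun x hx ↦ by
      refine mem_map_nilradical_of_forall_tmul_eq_zero fun 𝔭 _ h𝔭 ↦
        one_tmul_eq_zero_of_tensorSelfBaseChange_eq_zero ?_
      have := Ideal.pow_right_mono (Ideal.map_le_iff_le_comap.2 (h𝔞 ⟨𝔭, h𝔭⟩)) (e + e)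
        (Ideal.map_pow (h ⟨𝔭, h𝔭⟩) 𝔞 _ ▸ Ideal.mem_map_of_mem (h ⟨𝔭, h𝔭⟩) hx)
      rwa [h𝔟] at this
    obtain ⟨r, hr⟩ := IsNoetherianRing.isNilpotent_nilradical R
    refine ⟨(e + e) * r, ?_⟩
    rw [pow_mul, Ideal.zero_eq_bot, eq_bot_iff]
    refine (Ideal.pow_right_mono hle r).trans ?_
    rw [← Ideal.map_pow, hr, Ideal.zero_eq_bot, Ideal.map_bot]
  · refine Ideal.mem_iInf.2 fun 𝔭 ↦ ?_
    have hp0 :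
        (p : (𝔭.1.ResidueField ⊗[R] B) ⊗[𝔭.1.ResidueField] (𝔭.1.ResidueField ⊗[R] B)) = 0 := by
      rw [← map_natCast (algebraMap 𝔭.1.ResidueField _), CharP.cast_eq_zero, map_zero]
    rw [Ideal.mem_comap, map_natCast, hp0]
    exact zero_mem _
  · refine .of_jointly_injective hFs (fun 𝔭 ↦ Ideal.quotientMap (𝔟 𝔭) (h 𝔭) (h𝔞 𝔭)) fun x hx ↦ ?_
    obtain ⟨x, rfl⟩ := Ideal.Quotient.mk_surjective x
    refine Ideal.Quotient.eq_zero_iff_mem.2 (Ideal.mem_iInf.2 fun 𝔭 ↦ ?_)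
    have hx𝔭 : Ideal.Quotient.mk (𝔟 𝔭) (h 𝔭 x) = 0 := hx 𝔭
    exact Ideal.mem_comap.2 (Ideal.Quotient.eq_zero_iff_mem.1 hx𝔭)
end
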